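/- (Theorem 2.1, sufficiency) Let ν > -1, let (a_n)_{n≥1} be a real sequence with a_1 ≠ 0, and let L_f be the associated operator on real polynomials. Let α be a finite signed measure on ℝ such that x ↦ x^n is integrable with respect to its total variation measure for every n, with moments μ_n = ∫ x^n dα(x), and suppose μ_0 ≠ 0. Then there exists a unique sequence of real polynomials (s_n)_{n≥0} with deg s_n = n such that ∫ (L_f^r s_n)(x) dα(x) = γ_{n,ν}·δ_{n,r} for all n, r ∈ ℕ; moreover this sequence satisfies L_f s_{n+1} = (γ_{n+1,ν}/γ_{n,ν})·s_n for every n ≥ 0. -/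

import Mathlib

open Polynomial MeasureTheory

noncomputable def gammaDunkl (ν : ℝ) (n : ℕ) : ℝ :=
  if Even n then 2 ^ n * (Nat.factorial (n / 2)) * (ascPochhammer ℝ (n / 2)).eval (ν + 1)
  else 2 ^ n * (Nat.factorial (n / 2)) * (ascPochhammer ℝ (n / 2 + 1)).eval (ν + 1)

noncomputable def dunklOp (ν : ℝ) (p : Polynomial ℝ) : Polynomial ℝ :=
  derivative p + C ((2 * ν + 1) / 2) * (p - p.comp (-X)).divX

/-- The operator `L_f p = Σ_{n≥1} (a_n/γ_{n,ν}) Λ_ν^n p` (a finite sum). -/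
noncomputable def dunklLf (ν : ℝ) (a : ℕ → ℝ) (p : Polynomial ℝ) : Polynomial ℝ :=
  ∑ n ∈ Finset.Icc 1 p.natDegree, C (a n / gammaDunkl ν n) * (dunklOp ν)^[n] p

/-- Integral of a real function against a (finite) signed measure, via its
Jordan decomposition. -/
noncomputable def sintegral (α : SignedMeasure ℝ) (f : ℝ → ℝ) : ℝ :=
  (∫ x, f x ∂α.toJordanDecomposition.posPart) - ∫ x, f x ∂α.toJordanDecomposition.negPart

/-- The multiplier of `X ^ m ↦ X ^ (m - 1)` under the Dunkl operator. -/
noncomputable def dunklWeight (ν : ℝ) (m : ℕ) : ℝ :=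
  m + (2 * ν + 1) / 2 * (1 - (-1) ^ m)

theorem dunklWeight_succ_ne_zero {ν : ℝ} (hν : -1 < ν) (m : ℕ) :
    dunklWeight ν (m + 1) ≠ 0 := by
  unfold dunklWeight
  have hm : (0 : ℝ) ≤ m := Nat.cast_nonneg m
  rcases Nat.even_or_odd (m + 1) with h | h
  · rw [h.neg_one_pow]; push_cast; nlinarith
  · rw [h.neg_one_pow]; push_cast; apply ne_of_gt; nlinarith

theorem gammaDunkl_pos {ν : ℝ} (hν : -1 < ν) (n : ℕ) : 0 < gammaDunkl ν n := by
  have h : 0 < ν + 1 := by linarith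
  have h₀ := ascPochhammer_pos (n / 2) (ν + 1) h
  have h₁ := ascPochhammer_pos (n / 2 + 1) (ν + 1) h
  unfold gammaDunkl
  split_ifs <;> positivity

theorem coeff_dunklOp (ν : ℝ) (p : ℝ[X]) (k : ℕ) :
    (dunklOp ν p).coeff k = dunklWeight ν (k + 1) * p.coeff (k + 1) := by
  have h : (p.comp (-X)).coeff (k + 1) = p.coeff (k + 1) * (-1) ^ (k + 1) := by
    rw [show (-X : ℝ[X]) = C (-1) * X by simp, comp_C_mul_X_coeff]
  simp only [dunklOp, dunklWeight, coeff_add, coeff_derivative, coeff_C_mul, coeff_divX,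
    coeff_sub, h]
  push_cast
  ring

theorem coeff_iterate_dunklOp (ν : ℝ) (p : ℝ[X]) (j k : ℕ) :
    ((dunklOp ν)^[j] p).coeff k =
      (∏ i ∈ Finset.range j, dunklWeight ν (k + i + 1)) * p.coeff (k + j) := by
  induction j generalizing p with
  | zero => simp
  | succ j ih =>
    rw [Function.iterate_succ_apply, ih, coeff_dunklOp, Finset.prod_range_succ]
    ring_nf

theorem coeff_dunklLf (ν : ℝ) (a : ℕ → ℝ) (p : ℝ[X]) (k : ℕ) {N : ℕ} (hN : p.natDegree ≤ N) :
    (dunklLf ν a p).coeff k = ∑ n ∈ Finset.Icc 1 N, a n / gammaDunkl ν n *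
      ((∏ i ∈ Finset.range n, dunklWeight ν (k + i + 1)) * p.coeff (k + n)) := by
  simp only [dunklLf, finsetSum_coeff, coeff_C_mul, coeff_iterate_dunklOp]
  apply Finset.sum_subset (Finset.Icc_subset_Icc_right hN)
  intro n hn hn'
  simp only [Finset.mem_Icc] at hn hn'
  rw [coeff_eq_zero_of_natDegree_lt (by omega)]
  simp

/-- `dunklLf` as a linear map. -/
noncomputable def dunklLfLinear (ν : ℝ) (a : ℕ → ℝ) : ℝ[X] →ₗ[ℝ] ℝ[X] where
  toFun := dunklLf ν a
  map_add' p q := by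
    ext k
    rw [coeff_add, coeff_dunklLf ν a p k (le_max_left _ q.natDegree),
      coeff_dunklLf ν a q k (le_max_right p.natDegree _),
      coeff_dunklLf ν a (p + q) k (natDegree_add_le p q), ← Finset.sum_add_distrib]
    refine Finset.sum_congr rfl fun n _ => ?_
    rw [coeff_add]
    ring
  map_smul' c p := by
    ext k
    rw [RingHom.id_apply, coeff_smul, coeff_dunklLf ν a (c • p) k (natDegree_smul_le c p),
      coeff_dunklLf ν a p k le_rfl, Finset.smul_sum]
    refine Finset.sum_congr rfl fun n _ => ?_
    rw [coeff_smul, smul_eq_mul, smul_eq_mul]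
    ring

theorem coeff_dunklLf_of_natDegree_le (ν : ℝ) (a : ℕ → ℝ) {p : ℝ[X]} {d k : ℕ}
    (hp : p.natDegree ≤ d) (hk : d ≤ k) : (dunklLf ν a p).coeff k = 0 := by
  rw [coeff_dunklLf ν a p k le_rfl]
  refine Finset.sum_eq_zero fun n hn => ?_
  rw [coeff_eq_zero_of_natDegree_lt (by have := (Finset.mem_Icc.1 hn).1; omega)]
  simp

theorem coeff_dunklLf_of_natDegree_le_succ (ν : ℝ) (a : ℕ → ℝ) {p : ℝ[X]} {d : ℕ}
    (hp : p.natDegree ≤ d + 1) : (dunklLf ν a p).coeff d =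
      a 1 / gammaDunkl ν 1 * (dunklWeight ν (d + 1) * p.coeff (d + 1)) := by
  rw [coeff_dunklLf ν a p d hp, Finset.sum_eq_single_of_mem 1 (by simp)]
  · simp
  · intro n hn hn'
    rw [coeff_eq_zero_of_natDegree_lt (by have := (Finset.mem_Icc.1 hn).1; omega)]
    simp

/-- A linear operator on polynomials that behaves, on degrees, like a derivation: it kills
constants and lowers the degree of every other polynomial by exactly one. -/
structure LowersDegree (L : ℝ[X] →ₗ[ℝ] ℝ[X]) : Prop where
  map_const (c : ℝ) : L (C c) = 0
  natDegree_map (p : ℝ[X]) (n : ℕ) (hp : p.natDegree = n + 1) : (L p).natDegree = n ∧ L p ≠ 0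

theorem lowersDegree_dunklLfLinear {ν : ℝ} (hν : -1 < ν) {a : ℕ → ℝ} (ha : a 1 ≠ 0) :
    LowersDegree (dunklLfLinear ν a) where
  map_const c := by simp [dunklLfLinear, dunklLf]
  natDegree_map p n hp := by
    have hlead : (dunklLf ν a p).coeff n ≠ 0 := by
      rw [coeff_dunklLf_of_natDegree_le_succ ν a hp.le]
      refine mul_ne_zero (div_ne_zero ha (gammaDunkl_pos hν 1).ne')
        (mul_ne_zero (dunklWeight_succ_ne_zero hν n) ?_)
      rw [← hp, coeff_natDegree, Ne, leadingCoeff_eq_zero]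
      rintro rfl
      simp at hp
    refine ⟨natDegree_eq_of_le_of_coeff_ne_zero ?_ hlead, fun h => hlead ?_⟩
    · exact natDegree_le_iff_coeff_eq_zero.2 fun k hk =>
        coeff_dunklLf_of_natDegree_le ν a hp.le hk
    · rw [show dunklLf ν a p = 0 from h, coeff_zero]

namespace LowersDegree

variable {L : ℝ[X] →ₗ[ℝ] ℝ[X]}

theorem surjective (hL : LowersDegree L) : Function.Surjective L := by
  suffices h : ∀ (n : ℕ) (q : ℝ[X]), q.degree < n → ∃ p, L p = q from
    fun q => h (q.natDegree + 1) q (by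
      exact_mod_cast degree_le_natDegree.trans_lt (by exact_mod_cast Nat.lt_succ_self _))
  intro n
  induction n with
  | zero =>
    intro q hq
    refine ⟨0, ?_⟩
    rw [map_zero]
    ext k
    simp [(degree_lt_iff_coeff_zero q 0).1 hq k (Nat.zero_le k)]
  | succ n ih =>
    intro q hq
    obtain ⟨hdeg, hne⟩ := hL.natDegree_map (X ^ (n + 1)) n (natDegree_X_pow _)
    have hc : (L (X ^ (n + 1))).coeff n ≠ 0 := by
      have := leadingCoeff_ne_zero.2 hne
      rwa [leadingCoeff, hdeg] at this
    set c := q.coeff n / (L (X ^ (n + 1))).coeff n with hcdef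
    obtain ⟨p, hp⟩ := ih (q - c • L (X ^ (n + 1))) (by
      rw [degree_lt_iff_coeff_zero]
      intro k hk
      rw [coeff_sub, coeff_smul, smul_eq_mul]
      rcases hk.eq_or_lt with rfl | hk
      · rw [hcdef, div_mul_cancel₀ _ hc, sub_self]
      · rw [(degree_lt_iff_coeff_zero q (n + 1)).1 hq k hk,
          coeff_eq_zero_of_natDegree_lt (hdeg.trans_lt hk)]
        simp)
    exact ⟨p + c • X ^ (n + 1), by rw [map_add, map_smul, hp, sub_add_cancel]⟩

variable {φ : ℝ[X] →ₗ[ℝ] ℝ}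

theorem eq_zero_of_iterate (hL : LowersDegree L) (hφ : φ 1 ≠ 0) {p : ℝ[X]}
    (h : ∀ r, φ (L^[r] p) = 0) : p = 0 := by
  induction hn : p.natDegree generalizing p with
  | zero =>
    have h0 := h 0
    rw [eq_C_of_natDegree_eq_zero hn] at h0 ⊢
    rw [Function.iterate_zero_apply, ← mul_one (C _), ← smul_eq_C_mul, map_smul, smul_eq_mul] at h0
    rw [(mul_eq_zero.1 h0).resolve_right hφ, C_0]
  | succ n ih =>
    obtain ⟨hd, hne⟩ := hL.natDegree_map p n hn
    exact absurd (ih (fun r => h (r + 1)) hd) hne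

theorem iterate_ext (hL : LowersDegree L) (hφ : φ 1 ≠ 0) {p q : ℝ[X]}
    (h : ∀ r, φ (L^[r] p) = φ (L^[r] q)) : p = q :=
  sub_eq_zero.1 <| hL.eq_zero_of_iterate hφ fun r => by
    rw [← Module.End.pow_apply, map_sub, map_sub, Module.End.pow_apply, Module.End.pow_apply, h,
      sub_self]

theorem exists_preimage_apply_eq_zero (hL : LowersDegree L) (hφ : φ 1 ≠ 0) (q : ℝ[X]) :
    ∃ p, L p = q ∧ φ p = 0 := by
  obtain ⟨p, hp⟩ := hL.surjective q
  refine ⟨p - C (φ p / φ 1), by rw [map_sub, hp, hL.map_const, sub_zero], ?_⟩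
  rw [← mul_one (C _), ← smul_eq_C_mul, map_sub, map_smul, smul_eq_mul, div_mul_cancel₀ _ hφ,
    sub_self]

theorem exists_biorthogonal (hL : LowersDegree L) (hφ : φ 1 ≠ 0) {γ : ℕ → ℝ} (hγ : ∀ n, γ n ≠ 0) :
    ∃ s : ℕ → ℝ[X], (∀ n, (s n).natDegree = n) ∧
      ∀ n r, φ (L^[r] (s n)) = γ n * (if n = r then 1 else 0) := by
  choose g hg hg' using hL.exists_preimage_apply_eq_zero hφ
  let s : ℕ → ℝ[X] := fun n =>
    Nat.rec (C (γ 0 / φ 1)) (fun n q => g ((γ (n + 1) / γ n) • q)) n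
  have hs0 : s 0 = C (γ 0 / φ 1) := rfl
  have hs (n : ℕ) : L (s (n + 1)) = (γ (n + 1) / γ n) • s n := hg _
  have hs' (n : ℕ) : φ (s (n + 1)) = 0 := hg' _
  have hdeg (n : ℕ) : (s n).natDegree = n ∧ s n ≠ 0 := by
    induction n with
    | zero => simp [hs0, hγ 0, hφ]
    | succ n ih =>
      have hc : γ (n + 1) / γ n ≠ 0 := div_ne_zero (hγ _) (hγ _)
      have hne : L (s (n + 1)) ≠ 0 := by rw [hs]; exact smul_ne_zero hc ih.2
      refine ⟨?_, fun h => hne (by rw [h, map_zero])⟩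
      have hLdeg : (L (s (n + 1))).natDegree = n := by rw [hs, natDegree_smul _ hc, ih.1]
      cases hm : (s (n + 1)).natDegree with
      | zero =>
        rw [eq_C_of_natDegree_eq_zero hm, hL.map_const] at hne
        exact absurd rfl hne
      | succ m => rw [← (hL.natDegree_map _ m hm).1, hLdeg]
  refine ⟨s, fun n => (hdeg n).1, fun n r => ?_⟩
  induction r generalizing n with
  | zero =>
    cases n with
    | zero =>
      rw [Function.iterate_zero_apply, hs0, ← mul_one (C _), ← smul_eq_C_mul, map_smul,
        smul_eq_mul, div_mul_cancel₀ _ hφ]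
      simp
    | succ n => simp [hs']
  | succ r ih =>
    rw [Function.iterate_succ_apply]
    cases n with
    | zero => rw [hs0, hL.map_const, ← Module.End.pow_apply, map_zero, map_zero]; simp
    | succ n =>
      rw [hs, ← Module.End.pow_apply, map_smul, map_smul, Module.End.pow_apply, ih, smul_eq_mul,
        ← mul_assoc, div_mul_cancel₀ _ (hγ n)]
      simp

theorem map_biorthogonal_succ (hL : LowersDegree L) (hφ : φ 1 ≠ 0) {γ : ℕ → ℝ}
    (hγ : ∀ n, γ n ≠ 0) {s : ℕ → ℝ[X]}
    (hs : ∀ n r, φ (L^[r] (s n)) = γ n * (if n = r then 1 else 0)) (n : ℕ) :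
    L (s (n + 1)) = (γ (n + 1) / γ n) • s n :=
  hL.iterate_ext hφ fun r => by
    rw [← Function.iterate_succ_apply, hs, ← Module.End.pow_apply, map_smul, map_smul,
      Module.End.pow_apply, hs, smul_eq_mul, ← mul_assoc, div_mul_cancel₀ _ (hγ n)]
    simp

end LowersDegree

theorem integrable_eval_of_integrable_pow {μ : Measure ℝ}
    (h : ∀ n : ℕ, Integrable (fun x : ℝ => x ^ n) μ) (p : ℝ[X]) :
    Integrable (fun x => p.eval x) μ := by
  simp only [eval_eq_sum_range]
  exact integrable_finsetSum _ fun n _ => (h n).const_mul _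

/-- Integration of polynomials against a signed measure with finite moments. -/
noncomputable def momentFunctional (α : SignedMeasure ℝ)
    (hint : ∀ n : ℕ, Integrable (fun x : ℝ => x ^ n) α.totalVariation) : ℝ[X] →ₗ[ℝ] ℝ where
  toFun p := sintegral α (fun x => p.eval x)
  map_add' p q := by
    have h (p : ℝ[X]) := integrable_add_measure.1 (integrable_eval_of_integrable_pow hint p)
    simp only [sintegral, eval_add]
    rw [integral_add (h p).1 (h q).1, integral_add (h p).2 (h q).2]
    ring
  map_smul' c p := by
    simp only [sintegral, eval_smul, smul_eq_mul, integral_const_mul, RingHom.id_apply]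
    ring

/-- Theorem 2.1, sufficiency (Thorne theorem for Sheffer-Dunkl polynomials). -/
theorem thorne_sufficiency (ν : ℝ) (hν : -1 < ν) (a : ℕ → ℝ) (ha : a 1 ≠ 0)
    (α : SignedMeasure ℝ)
    (hint : ∀ n : ℕ, Integrable (fun x : ℝ => x ^ n) α.totalVariation)
    (hμ0 : sintegral α (fun x => x ^ 0) ≠ 0) :
    (∃! s : ℕ → Polynomial ℝ,
      (∀ n, (s n).natDegree = n) ∧
      ∀ n r : ℕ, sintegral α (fun x => ((dunklLf ν a)^[r] (s n)).eval x)
        = gammaDunkl ν n * (if n = r then 1 else 0)) ∧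
    (∀ s : ℕ → Polynomial ℝ,
      ((∀ n, (s n).natDegree = n) ∧
        ∀ n r : ℕ, sintegral α (fun x => ((dunklLf ν a)^[r] (s n)).eval x)
          = gammaDunkl ν n * (if n = r then 1 else 0)) →
      ∀ n : ℕ, dunklLf ν a (s (n + 1))
        = C (gammaDunkl ν (n + 1) / gammaDunkl ν n) * s n) := by
  have hL := lowersDegree_dunklLfLinear hν ha
  have hγ (n : ℕ) : gammaDunkl ν n ≠ 0 := (gammaDunkl_pos hν n).ne'
  have hφ : momentFunctional α hint 1 ≠ 0 := by
    simpa [momentFunctional] using hμ0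
  refine ⟨?_, fun s hs n => ?_⟩
  · obtain ⟨s, hdeg, hs⟩ := hL.exists_biorthogonal hφ hγ
    refine ⟨s, ⟨hdeg, hs⟩, fun t ht => funext fun n => hL.iterate_ext hφ fun r => ?_⟩
    exact (ht.2 n r).trans (hs n r).symm
  · rw [← smul_eq_C_mul]
    exact hL.map_biorthogonal_succ hφ hγ hs.2 n
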